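/- Let n ≥ 2 and 0 < σ < 1/2 with σ(n+1) < n. There exist constants c, C > 0 depending only on n, σ and η such that for all R ≥ 2 with R^{σ} ≥ 2, R^{1-σ} ≥ 40 and R^{1-2σ} ≥ 80 the following holds. Let Ω̃ ⊆ ℝⁿ be the union of the closed balls of radius 1/R centred at the points (x', x_n) with x'_j = p_j R^{σ-1} for natural numbers p_j ≤ (1/40) R^{1-σ} and x_n = 2q R^{2σ-1} for a natural number q ≤ (1/80) R^{1-2σ}, and let μ be Lebesgue measure restricted to Ω̃. Then for 0 ≤ η ≤ n: if η ≤ n - σ(n+1) then c R^{-σ(n+1)} ≤ sup_{x ∈ ℝⁿ, r > 0} μ(B(x,r))/r^η ≤ C R^{-σ(n+1)}, while if n - σ(n+1) ≤ η ≤ n then c R^{η-n} ≤ sup_{x ∈ ℝⁿ, r > 0} μ(B(x,r))/r^η ≤ C R^{η-n}. -/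

import Mathlib

open Real MeasureTheory ENNReal

/-- The lattice point with integer coordinates `f` and mesh size `d j` in direction `j`. -/
noncomputable def latticePoint {ι : Type*} (d : ι → ℝ) (f : ι → ℕ) : EuclideanSpace ℝ ι :=
  WithLp.toLp 2 fun j => (f j : ℝ) * d j

/-- The union of the closed balls of radius `ρ` around the lattice points whose `j`-th integer
coordinate is at most `N j`. -/
def latticeBalls {ι : Type*} [Fintype ι] [DecidableEq ι] (d : ι → ℝ) (N : ι → ℕ) (ρ : ℝ) :
    Set (EuclideanSpace ℝ ι) :=
  ⋃ f ∈ Fintype.piFinset fun j => Finset.range (N j + 1), Metric.closedBall (latticePoint d f) ρ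

/-- The volume of the Euclidean unit ball. -/
noncomputable def unitBallVolume (ι : Type*) [Fintype ι] : ℝ :=
  (volume (Metric.ball (0 : EuclideanSpace ℝ ι) 1)).toReal

lemma unitBallVolume_pos (ι : Type*) [Fintype ι] : 0 < unitBallVolume ι :=
  ENNReal.toReal_pos (Metric.measure_ball_pos _ _ one_pos).ne' measure_ball_lt_top.ne

lemma volume_closedBall_eq {ι : Type*} [Fintype ι] (x : EuclideanSpace ℝ ι) {r : ℝ}
    (hr : 0 ≤ r) :
    volume (Metric.closedBall x r) =
      ENNReal.ofReal (r ^ Fintype.card ι * unitBallVolume ι) := by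
  rw [Measure.addHaar_closedBall _ _ hr, finrank_euclideanSpace,
    ENNReal.ofReal_mul (by positivity), unitBallVolume,
    ENNReal.ofReal_toReal measure_ball_lt_top.ne]

lemma abs_apply_sub_le_dist {ι : Type*} [Fintype ι] (x y : EuclideanSpace ℝ ι) (j : ι) :
    |x j - y j| ≤ dist x y := by
  rw [dist_eq_norm]
  simpa using PiLp.norm_apply_le (x - y) j

/-- The number of points of `{0, d, …, N d}` in an interval of length `4 r`. -/
lemma card_filter_range_le (d x r : ℝ) (N : ℕ) (hd : 0 < d) (hr : 0 < r) (hN : N * d ≤ 1) :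
    (({k ∈ Finset.range (N + 1) | |(k : ℝ) * d - x| ≤ 2 * r} : Finset ℕ).card : ℝ) ≤
      1 + 4 * min r 1 / d := by
  set T := ({k ∈ Finset.range (N + 1) | |(k : ℝ) * d - x| ≤ 2 * r} : Finset ℕ) with hT
  have hs : 0 < min r 1 := lt_min hr one_pos
  rcases T.eq_empty_or_nonempty with h | h
  · rw [h]
    simp only [Finset.card_empty, Nat.cast_zero]
    positivity
  · have hsub : T ⊆ Finset.Icc (T.min' h) (T.min' h + ⌊4 * min r 1 / d⌋₊) := by
      intro k hk
      have hmin := T.min'_le k hk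
      rw [Finset.mem_Icc]
      refine ⟨hmin, ?_⟩
      have hm := T.min'_mem h
      generalize T.min' h = m at hm hmin
      rw [hT, Finset.mem_filter, Finset.mem_range] at hm hk
      have hk1 : (k : ℝ) ≤ N := by exact_mod_cast Nat.lt_succ_iff.1 hk.1
      have h1 := abs_le.1 hk.2
      have h2 := abs_le.1 hm.2
      have hm0 : (0 : ℝ) ≤ m * d := by positivity
      have h3 : ((k : ℝ) - m) * d ≤ 4 * min r 1 := by
        rcases min_choice r 1 with e | e <;> rw [e] <;> nlinarith
      have h4 : ((k - m : ℕ) : ℝ) ≤ 4 * min r 1 / d := by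
        rw [Nat.cast_sub hmin, le_div_iff₀ hd]
        exact h3
      have h5 := Nat.le_floor h4
      omega
    have h1 := Finset.card_le_card hsub
    rw [Nat.card_Icc] at h1
    have h2 : (T.card : ℝ) ≤ 1 + ⌊4 * min r 1 / d⌋₊ := by
      have : T.card ≤ 1 + ⌊4 * min r 1 / d⌋₊ := by omega
      exact_mod_cast this
    have h3 := Nat.floor_le (show 0 ≤ 4 * min r 1 / d by positivity)
    linarith

lemma volume_closedBall_inter_latticeBalls_le {ι : Type*} [Fintype ι] [DecidableEq ι]
    (d : ι → ℝ) (N : ι → ℕ) (ρ r : ℝ) (hρ : 0 < ρ) (hr : ρ ≤ r) (hd : ∀ j, 0 < d j)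
    (hN : ∀ j, N j * d j ≤ 1) (x : EuclideanSpace ℝ ι) :
    volume (Metric.closedBall x r ∩ latticeBalls d N ρ) ≤
      ENNReal.ofReal ((∏ j, (1 + 4 * min r 1 / d j)) *
        (ρ ^ Fintype.card ι * unitBallVolume ι)) := by
  set T : ι → Finset ℕ := fun j =>
    {k ∈ Finset.range (N j + 1) | |(k : ℝ) * d j - x j| ≤ 2 * r} with hT
  have hr0 : 0 < r := hρ.trans_le hr
  have hV := (unitBallVolume_pos ι).le
  have hsub : Metric.closedBall x r ∩ latticeBalls d N ρ ⊆
      ⋃ f ∈ Fintype.piFinset T, Metric.closedBall (latticePoint d f) ρ := by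
    rintro y ⟨hyx, hy⟩
    simp only [latticeBalls, Set.mem_iUnion, Fintype.mem_piFinset] at hy ⊢
    obtain ⟨f, hf, hy⟩ := hy
    refine ⟨f, fun j => Finset.mem_filter.2 ⟨hf j, ?_⟩, hy⟩
    have h1 : dist (latticePoint d f) x ≤ 2 * r := by
      have := dist_triangle_left (latticePoint d f) x y
      rw [Metric.mem_closedBall] at hy hyx
      linarith
    exact (abs_apply_sub_le_dist (latticePoint d f) x j).trans h1
  refine (measure_mono hsub).trans ((measure_biUnion_finset_le _ _).trans ?_)
  simp only [volume_closedBall_eq _ hρ.le, Finset.sum_const, nsmul_eq_mul]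
  rw [← ENNReal.ofReal_natCast, ← ENNReal.ofReal_mul (by positivity), Fintype.card_piFinset]
  refine ENNReal.ofReal_le_ofReal (mul_le_mul_of_nonneg_right ?_ (by positivity))
  push_cast
  exact Finset.prod_le_prod (fun _ _ => by positivity) fun j _ =>
    card_filter_range_le (d j) (x j) r (N j) (hd j) hr0 (hN j)

lemma le_volume_latticeBalls {ι : Type*} [Fintype ι] [DecidableEq ι]
    (d : ι → ℝ) (N : ι → ℕ) (ρ : ℝ) (hρ : 0 < ρ) (hd : ∀ j, 2 * ρ ≤ d j) :
    ENNReal.ofReal ((∏ j, ((N j : ℝ) + 1)) *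
        ((ρ / 3) ^ Fintype.card ι * unitBallVolume ι)) ≤
      volume (latticeBalls d N ρ) := by
  have hsub : (⋃ f ∈ Fintype.piFinset fun j => Finset.range (N j + 1),
      Metric.closedBall (latticePoint d f) (ρ / 3)) ⊆ latticeBalls d N ρ :=
    Set.iUnion₂_mono fun f _ => Metric.closedBall_subset_closedBall (by linarith)
  refine le_trans (le_of_eq ?_) (measure_mono hsub)
  rw [measure_biUnion_finset]
  · simp only [volume_closedBall_eq _ (show 0 ≤ ρ / 3 by positivity), Finset.sum_const,
      nsmul_eq_mul]
    rw [← ENNReal.ofReal_natCast, ← ENNReal.ofReal_mul (by positivity), Fintype.card_piFinset]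
    simp
  · intro f _ g _ hfg
    refine Metric.closedBall_disjoint_closedBall ?_
    obtain ⟨j, hj⟩ := Function.ne_iff.1 hfg
    refine lt_of_lt_of_le ?_ (abs_apply_sub_le_dist _ _ j)
    have h1 : (1 : ℝ) ≤ |(f j : ℝ) - g j| := by
      have : (1 : ℤ) ≤ |(f j : ℤ) - g j| := Int.one_le_abs (by omega)
      exact_mod_cast this
    have h2 := hd j
    calc ρ / 3 + ρ / 3 < d j := by linarith
      _ ≤ |(f j : ℝ) - g j| * d j := le_mul_of_one_le_left (by linarith) h1
      _ = |latticePoint d f j - latticePoint d g j| := by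
        simp only [latticePoint]
        rw [← sub_mul, abs_mul, abs_of_pos (show 0 < d j by linarith)]
  · exact fun _ _ => measurableSet_closedBall

lemma latticeBalls_subset_closedBall {ι : Type*} [Fintype ι] [DecidableEq ι]
    (d : ι → ℝ) (N : ι → ℕ) (ρ : ℝ) (hρ : ρ ≤ 1) (hd : ∀ j, 0 < d j)
    (hN : ∀ j, N j * d j ≤ 1) :
    latticeBalls d N ρ ⊆ Metric.closedBall 0 ((Fintype.card ι : ℝ) + 1) := by
  refine Set.iUnion₂_subset fun f hf => Metric.closedBall_subset_closedBall' ?_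
  have h : dist (latticePoint d f) 0 ≤ Fintype.card ι := by
    rw [dist_zero_right, EuclideanSpace.norm_eq]
    have h1 : ∑ j, ‖latticePoint d f j‖ ^ 2 ≤ Fintype.card ι := by
      have : ∀ j ∈ Finset.univ, ‖latticePoint d f j‖ ^ 2 ≤ 1 := by
        intro j _
        have hfj : (f j : ℝ) ≤ N j := by
          exact_mod_cast Nat.lt_succ_iff.1 (Finset.mem_range.1 (Fintype.mem_piFinset.1 hf j))
        have h0 : 0 ≤ (f j : ℝ) * d j := mul_nonneg (by positivity) (hd j).le
        simp only [latticePoint]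
        rw [Real.norm_of_nonneg h0]
        exact pow_le_one₀ h0 ((mul_le_mul_of_nonneg_right hfj (hd j).le).trans (hN j))
      simpa using Finset.sum_le_card_nsmul _ _ _ this
    refine Real.sqrt_le_iff.2 ⟨by positivity, h1.trans ?_⟩
    exact_mod_cast Nat.le_self_pow two_ne_zero _
  linarith

lemma prod_ite_lt_pred {M : Type*} [CommMonoid M] (n : ℕ) (hn : n ≠ 0) (u w : M) :
    ∏ j : Fin n, (if (j : ℕ) < n - 1 then u else w) = u ^ (n - 1) * w := by
  obtain ⟨m, rfl⟩ := Nat.exists_eq_succ_of_ne_zero hn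
  simp [Fin.prod_univ_castSucc]

/-- The exponent of `R` in `μ(B(x, r)) / r ^ η` for `r = R ^ (-t)`. -/
lemma density_exponent_le (n σ η t : ℝ) (hσ0 : 0 < σ) (hσ1 : σ < 1 / 2)
    (hη0 : 0 ≤ η) (hηn : η ≤ n) (ht0 : 0 ≤ t) (ht1 : t ≤ 1) :
    (n - 1) * max 0 (1 - σ - t) + max 0 (1 - 2 * σ - t) - n + η * t ≤
      max (η - n) (-(σ * (n + 1))) := by
  rcases le_total (1 - σ) t with h1 | h1
  · rw [max_eq_left (by linarith), max_eq_left (by linarith)]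
    refine le_max_of_le_left ?_
    nlinarith
  rcases le_total (1 - 2 * σ) t with h2 | h2
  · rw [max_eq_right (by linarith), max_eq_left (by linarith)]
    rcases le_total η (n - 1) with h3 | h3
    · refine le_max_of_le_right ?_
      nlinarith [mul_nonneg (sub_nonneg.2 h3) (sub_nonneg.2 h2),
        mul_nonneg (sub_nonneg.2 hηn) (show 0 ≤ 1 - 2 * σ by linarith)]
    · refine le_max_of_le_left ?_
      nlinarith [mul_nonneg (sub_nonneg.2 h3) (sub_nonneg.2 h1), mul_nonneg hη0 hσ0.le]
  · rw [max_eq_right (by linarith), max_eq_right (by linarith)]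
    refine le_max_of_le_right ?_
    nlinarith [mul_nonneg (sub_nonneg.2 hηn) ht0]

lemma one_add_mul_rpow_le (R k e : ℝ) (hR : 1 ≤ R) (hk : 0 ≤ k) :
    1 + k * R ^ e ≤ (1 + k) * R ^ max 0 e := by
  have h1 : 1 ≤ R ^ max 0 e := Real.one_le_rpow hR (le_max_left _ _)
  have h2 : R ^ e ≤ R ^ max 0 e := Real.rpow_le_rpow_of_exponent_le hR (le_max_right _ _)
  nlinarith

/-- The mesh sizes of the rescaled lattice. -/
noncomputable def mesh (n : ℕ) (σ R : ℝ) (j : Fin n) : ℝ :=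
  if (j : ℕ) < n - 1 then R ^ (σ - 1) else 2 * R ^ (2 * σ - 1)

/-- The numbers of lattice steps in the coordinate directions. -/
noncomputable def meshCount (n : ℕ) (σ R : ℝ) (j : Fin n) : ℕ :=
  if (j : ℕ) < n - 1 then ⌊(1 / 40) * R ^ (1 - σ)⌋₊ else ⌊(1 / 80) * R ^ (1 - 2 * σ)⌋₊

lemma mesh_pos (n : ℕ) (σ R : ℝ) (hR : 0 < R) (j : Fin n) : 0 < mesh n σ R j := by
  unfold mesh
  split_ifs <;> positivity

lemma meshCount_mul_mesh_le (n : ℕ) (σ R : ℝ) (hR : 0 < R) (j : Fin n) :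
    meshCount n σ R j * mesh n σ R j ≤ 1 := by
  have key : ∀ e : ℝ, R ^ e * R ^ (-e) = 1 := fun e => by
    rw [← Real.rpow_add hR, add_neg_cancel, Real.rpow_zero]
  unfold meshCount mesh
  split_ifs
  · have h := Nat.floor_le (show 0 ≤ (1 / 40) * R ^ (1 - σ) by positivity)
    have hk := key (1 - σ)
    rw [neg_sub] at hk
    have := mul_le_mul_of_nonneg_right h (show 0 ≤ R ^ (σ - 1) by positivity)
    nlinarith
  · have h := Nat.floor_le (show 0 ≤ (1 / 80) * R ^ (1 - 2 * σ) by positivity)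
    have hk := key (1 - 2 * σ)
    rw [neg_sub] at hk
    have := mul_le_mul_of_nonneg_right h (show 0 ≤ 2 * R ^ (2 * σ - 1) by positivity)
    nlinarith

lemma two_mul_inv_le_mesh (n : ℕ) (σ R : ℝ) (hR : 1 ≤ R) (hσ0 : 0 ≤ σ) (hRσ : 2 ≤ R ^ σ)
    (j : Fin n) : 2 * (1 / R) ≤ mesh n σ R j := by
  have hR0 : 0 < R := by linarith
  have h1 : R ^ (σ - 1) = R ^ σ * (1 / R) := by
    rw [Real.rpow_sub hR0, Real.rpow_one]
    ring
  have h2 : 2 * (1 / R) ≤ R ^ (σ - 1) := by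
    rw [h1]
    gcongr
  unfold mesh
  split_ifs
  · exact h2
  · have h3 : R ^ (σ - 1) ≤ R ^ (2 * σ - 1) :=
      Real.rpow_le_rpow_of_exponent_le hR (by linarith)
    have h4 : 0 < R ^ (2 * σ - 1) := by positivity
    linarith

lemma iUnion_closedBall_eq_latticeBalls (n : ℕ) (hn : n - 1 < n) (σ R : ℝ) (hR : 0 < R) :
    (⋃ z ∈ {z : EuclideanSpace ℝ (Fin n) |
        (∀ j : Fin n, (j : ℕ) < n - 1 →
          ∃ p : ℕ, (p : ℝ) ≤ (1/40) * R ^ (1 - σ) ∧ z j = (p : ℝ) * R ^ (σ - 1)) ∧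
        (∃ q : ℕ, (q : ℝ) ≤ (1/80) * R ^ (1 - 2*σ) ∧
          z ⟨n - 1, hn⟩ = 2 * (q : ℝ) * R ^ (2*σ - 1))},
      Metric.closedBall z (1/R)) =
    latticeBalls (mesh n σ R) (meshCount n σ R) (1 / R) := by
  have hA : 0 ≤ (1 / 40) * R ^ (1 - σ) := by positivity
  have hB : 0 ≤ (1 / 80) * R ^ (1 - 2 * σ) := by positivity
  apply Set.Subset.antisymm
  · refine Set.iUnion₂_subset fun z hz => ?_
    obtain ⟨h1, q, hq, hzq⟩ := hz
    choose p hp hzp using h1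
    let f : Fin n → ℕ := fun j => if h : (j : ℕ) < n - 1 then p j h else q
    have hf : f ∈ Fintype.piFinset fun j => Finset.range (meshCount n σ R j + 1) := by
      rw [Fintype.mem_piFinset]
      intro j
      rw [Finset.mem_range, Nat.lt_succ_iff]
      simp only [f, meshCount]
      split_ifs with h
      · exact Nat.le_floor (hp j h)
      · exact Nat.le_floor hq
    have hzf : z = latticePoint (mesh n σ R) f := by
      ext j
      simp only [latticePoint, mesh, f]
      split_ifs with h
      · exact hzp j h
      · have : j = ⟨n - 1, hn⟩ := Fin.ext (by have := j.2; simp only; omega)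
        rw [this, hzq]
        ring
    rw [hzf]
    exact Set.subset_biUnion_of_mem (u := fun f => Metric.closedBall
      (latticePoint (mesh n σ R) f) (1 / R)) (Finset.mem_coe.2 hf)
  · refine Set.iUnion₂_subset fun f hf => ?_
    refine Set.subset_biUnion_of_mem (u := fun z : EuclideanSpace ℝ (Fin n) =>
      Metric.closedBall z (1 / R)) ?_
    rw [Fintype.mem_piFinset] at hf
    refine ⟨fun j hj => ⟨f j, ?_, ?_⟩, f ⟨n - 1, hn⟩, ?_, ?_⟩
    · have := hf j
      rw [Finset.mem_range, Nat.lt_succ_iff, meshCount, if_pos hj] at this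
      exact (Nat.le_floor_iff hA).1 this
    · simp [latticePoint, mesh, hj]
    · have := hf ⟨n - 1, hn⟩
      rw [Finset.mem_range, Nat.lt_succ_iff, meshCount, if_neg (lt_irrefl _)] at this
      exact (Nat.le_floor_iff hB).1 this
    · simp only [latticePoint, mesh, lt_irrefl, if_false]
      ring

lemma volume_closedBall_inter_le_rpow (n : ℕ) (hn : 2 ≤ n) (σ : ℝ) (hσ0 : 0 < σ)
    (hσ1 : σ < 1 / 2) (η : ℝ) (hη0 : 0 ≤ η) (hηn : η ≤ (n : ℝ)) (R : ℝ) (hR : 2 ≤ R)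
    (x : EuclideanSpace ℝ (Fin n)) (r : ℝ) (hr : 0 < r) :
    volume (Metric.closedBall x r ∩
        latticeBalls (mesh n σ R) (meshCount n σ R) (1 / R)) ≤
      ENNReal.ofReal (5 ^ n * unitBallVolume (Fin n) *
        R ^ max (η - n) (-(σ * ((n : ℝ) + 1))) * r ^ η) := by
  have hR0 : 0 < R := by linarith
  have hR1 : 1 ≤ R := by linarith
  have hV := unitBallVolume_pos (Fin n)
  rcases le_total r (1 / R) with h | h
  · refine (measure_mono Set.inter_subset_left).trans ?_
    rw [volume_closedBall_eq _ hr.le, Fintype.card_fin]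
    refine ENNReal.ofReal_le_ofReal ?_
    have h1 : r ^ n = r ^ ((n : ℝ) - η) * r ^ η := by
      rw [← Real.rpow_add hr, sub_add_cancel, Real.rpow_natCast]
    have h2 : r ^ ((n : ℝ) - η) ≤ R ^ max (η - n) (-(σ * ((n : ℝ) + 1))) := by
      calc r ^ ((n : ℝ) - η) ≤ (1 / R) ^ ((n : ℝ) - η) :=
            Real.rpow_le_rpow hr.le h (by linarith)
        _ = R ^ (η - n) := by
            rw [one_div, Real.inv_rpow hR0.le, ← Real.rpow_neg hR0.le, neg_sub]
        _ ≤ _ := Real.rpow_le_rpow_of_exponent_le hR1 (le_max_left _ _)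
    have h3 : (1 : ℝ) ≤ 5 ^ n := one_le_pow₀ (by norm_num)
    calc r ^ n * unitBallVolume (Fin n)
        = 1 * unitBallVolume (Fin n) * r ^ ((n : ℝ) - η) * r ^ η := by rw [h1]; ring
      _ ≤ _ := by gcongr
  · refine (volume_closedBall_inter_latticeBalls_le _ _ _ r (by positivity) h
      (mesh_pos n σ R hR0) (meshCount_mul_mesh_le n σ R hR0) x).trans ?_
    refine ENNReal.ofReal_le_ofReal ?_
    have hs : 0 < min r 1 := lt_min hr one_pos
    have hRs : 1 / R ≤ min r 1 := le_min h (by rw [div_le_one hR0]; exact hR1)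
    have hsr : min r 1 ^ η ≤ r ^ η := Real.rpow_le_rpow hs.le (min_le_left _ _) hη0
    have hs1 : min r 1 ≤ 1 := min_le_right _ _
    generalize min r 1 = s at hs hRs hsr hs1
    obtain ⟨t, rfl⟩ : ∃ t, R ^ (-t) = s :=
      ⟨-Real.logb R s, by rw [neg_neg, Real.rpow_logb hR0 (by linarith) hs]⟩
    have ht0 : 0 ≤ t := by
      by_contra hcon
      have := Real.one_lt_rpow (show 1 < R by linarith) (show 0 < -t by linarith)
      linarith
    have ht1 : t ≤ 1 := by
      rw [one_div, ← Real.rpow_neg_one,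
        Real.rpow_le_rpow_left_iff (show 1 < R by linarith)] at hRs
      linarith
    have hprod : ∏ j, (1 + 4 * R ^ (-t) / mesh n σ R j) =
        (1 + 4 * R ^ (1 - σ - t)) ^ (n - 1) * (1 + 2 * R ^ (1 - 2 * σ - t)) := by
      rw [← prod_ite_lt_pred n (by omega)]
      refine Finset.prod_congr rfl fun j _ => ?_
      unfold mesh
      split_ifs
      · rw [mul_div_assoc, ← Real.rpow_sub hR0]
        ring_nf
      · rw [mul_div_mul_comm, ← Real.rpow_sub hR0]
        ring_nf
    have hcount : ∏ j, (1 + 4 * R ^ (-t) / mesh n σ R j) ≤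
        5 ^ n * R ^ (((n : ℝ) - 1) * max 0 (1 - σ - t) + max 0 (1 - 2 * σ - t)) := by
      rw [hprod]
      have h1 : 1 + 4 * R ^ (1 - σ - t) ≤ 5 * R ^ max 0 (1 - σ - t) := by
        convert one_add_mul_rpow_le R 4 (1 - σ - t) hR1 (by norm_num) using 2
        norm_num
      have h2 : 1 + 2 * R ^ (1 - 2 * σ - t) ≤ 5 * R ^ max 0 (1 - 2 * σ - t) := by
        refine (one_add_mul_rpow_le R 2 (1 - 2 * σ - t) hR1 (by norm_num)).trans ?_
        gcongr
        norm_num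
      calc (1 + 4 * R ^ (1 - σ - t)) ^ (n - 1) * (1 + 2 * R ^ (1 - 2 * σ - t))
          ≤ (5 * R ^ max 0 (1 - σ - t)) ^ (n - 1) * (5 * R ^ max 0 (1 - 2 * σ - t)) := by
            gcongr
        _ = 5 ^ (n - 1 + 1) *
            ((R ^ max 0 (1 - σ - t)) ^ (n - 1) * R ^ max 0 (1 - 2 * σ - t)) := by ring
        _ = _ := by
          rw [Nat.sub_add_cancel (by omega), ← Real.rpow_natCast (R ^ _) (n - 1),
            ← Real.rpow_mul hR0.le, ← Real.rpow_add hR0, Nat.cast_sub (by omega), Nat.cast_one,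
            mul_comm (max 0 (1 - σ - t))]
    have hρ : (1 / R) ^ n = R ^ (-(n : ℝ)) := by
      rw [Real.rpow_neg hR0.le, Real.rpow_natCast, one_div, inv_pow]
    have hst : R ^ (η * t) * (R ^ (-t)) ^ η = 1 := by
      rw [← Real.rpow_mul hR0.le, ← Real.rpow_add hR0, neg_mul, mul_comm t, add_neg_cancel,
        Real.rpow_zero]
    have hexp := Real.rpow_le_rpow_of_exponent_le hR1
      (density_exponent_le n σ η t hσ0 hσ1 hη0 hηn ht0 ht1)
    rw [Fintype.card_fin, hρ]
    set A := ((n : ℝ) - 1) * max 0 (1 - σ - t) + max 0 (1 - 2 * σ - t)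
    calc _ ≤ 5 ^ n * R ^ A * (R ^ (-(n : ℝ)) * unitBallVolume (Fin n)) := by gcongr
      _ = 5 ^ n * unitBallVolume (Fin n) * (R ^ A * R ^ (-(n : ℝ)) * R ^ (η * t)) *
          (R ^ (-t)) ^ η := by
        linear_combination (-(5 ^ n * R ^ A * (R ^ (-(n : ℝ)) * unitBallVolume (Fin n)))) * hst
      _ = 5 ^ n * unitBallVolume (Fin n) * R ^ (A - n + η * t) * (R ^ (-t)) ^ η := by
        rw [← Real.rpow_add hR0, ← Real.rpow_add hR0, sub_eq_add_neg]
      _ ≤ _ := by gcongr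

lemma rpow_le_volume_latticeBalls (n : ℕ) (hn : 2 ≤ n) (σ : ℝ) (hσ0 : 0 < σ) (R : ℝ)
    (hR : 2 ≤ R) (hRσ : 2 ≤ R ^ σ) :
    ENNReal.ofReal (unitBallVolume (Fin n) / 240 ^ n * R ^ (-(σ * ((n : ℝ) + 1)))) ≤
      volume (latticeBalls (mesh n σ R) (meshCount n σ R) (1 / R)) := by
  have hR0 : 0 < R := by linarith
  have hV := unitBallVolume_pos (Fin n)
  refine le_trans ?_ (le_volume_latticeBalls _ _ _ (by positivity)
    (two_mul_inv_le_mesh n σ R (by linarith) hσ0.le hRσ))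
  refine ENNReal.ofReal_le_ofReal ?_
  have hprod : ((1 / 80) * R ^ (1 - σ)) ^ (n - 1) * ((1 / 80) * R ^ (1 - 2 * σ)) ≤
      ∏ j, ((meshCount n σ R j : ℝ) + 1) := by
    rw [← prod_ite_lt_pred n (by omega)]
    refine Finset.prod_le_prod (fun j _ => ?_) fun j _ => ?_
    · split_ifs <;> positivity
    · unfold meshCount
      split_ifs
      · refine le_trans ?_ (Nat.lt_floor_add_one _).le
        gcongr
        norm_num
      · exact (Nat.lt_floor_add_one _).le
  have hρ : (1 / R / 3) ^ n = R ^ (-(n : ℝ)) / 3 ^ n := by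
    rw [Real.rpow_neg hR0.le, Real.rpow_natCast, one_div, div_pow, inv_pow]
  rw [Fintype.card_fin, hρ]
  refine le_trans (le_of_eq ?_) (mul_le_mul_of_nonneg_right hprod (by positivity))
  have hexp : R ^ (-(σ * ((n : ℝ) + 1))) =
      (R ^ (1 - σ)) ^ (n - 1) * R ^ (1 - 2 * σ) * R ^ (-(n : ℝ)) := by
    rw [← Real.rpow_natCast (R ^ _) (n - 1), ← Real.rpow_mul hR0.le, ← Real.rpow_add hR0,
      ← Real.rpow_add hR0, Nat.cast_sub (by omega), Nat.cast_one]
    ring_nf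
  have h240 : (240 : ℝ) ^ n = 80 ^ (n - 1) * 80 * 3 ^ n := by
    rw [← pow_succ, Nat.sub_add_cancel (by omega), ← mul_pow]
    norm_num
  rw [hexp, h240, mul_pow, div_pow, one_pow]
  field_simp

/-- For `μ` the Lebesgue measure restricted to the `1/R`-neighbourhood
`Ω̃` of the rescaled lattice, the quantity `sup_{x,r>0} μ(B(x,r))/r^η` is comparable to
`R^{-σ(n+1)}` for `η ≤ n - σ(n+1)` and to `R^{η-n}` for `n - σ(n+1) ≤ η ≤ n`. -/
theorem stmt13 (n : ℕ) (hn : 2 ≤ n) (σ : ℝ) (hσ0 : 0 < σ) (hσ1 : σ < 1/2)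
    (hσn : σ * ((n : ℝ) + 1) < n) (η : ℝ) (hη0 : 0 ≤ η) (hηn : η ≤ (n : ℝ)) :
    ∃ c C : ℝ, 0 < c ∧ 0 < C ∧
      ∀ R : ℝ, 2 ≤ R → 2 ≤ R ^ σ → 40 ≤ R ^ (1 - σ) → 80 ≤ R ^ (1 - 2*σ) →
      ∀ Ω : Set (EuclideanSpace ℝ (Fin n)),
        Ω = ⋃ z ∈ {z : EuclideanSpace ℝ (Fin n) |
              (∀ j : Fin n, (j : ℕ) < n - 1 →
                ∃ p : ℕ, (p : ℝ) ≤ (1/40) * R ^ (1 - σ) ∧ z j = (p : ℝ) * R ^ (σ - 1)) ∧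
              (∃ q : ℕ, (q : ℝ) ≤ (1/80) * R ^ (1 - 2*σ) ∧
                z ⟨n - 1, by omega⟩ = 2 * (q : ℝ) * R ^ (2*σ - 1))},
            Metric.closedBall z (1/R) →
      ∀ S : ℝ≥0∞,
        S = ⨆ (x : EuclideanSpace ℝ (Fin n)) (r : ℝ) (_ : 0 < r),
              (volume.restrict Ω) (Metric.closedBall x r) / ENNReal.ofReal (r ^ η) →
        ((η ≤ (n : ℝ) - σ * ((n : ℝ) + 1) →
            ENNReal.ofReal (c * R ^ (-(σ * ((n : ℝ) + 1)))) ≤ S ∧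
              S ≤ ENNReal.ofReal (C * R ^ (-(σ * ((n : ℝ) + 1))))) ∧
         ((n : ℝ) - σ * ((n : ℝ) + 1) ≤ η →
            ENNReal.ofReal (c * R ^ (η - (n : ℝ))) ≤ S ∧
              S ≤ ENNReal.ofReal (C * R ^ (η - (n : ℝ))))) := by
  have hV := unitBallVolume_pos (Fin n)
  have hK : 1 ≤ 240 ^ n * ((n : ℝ) + 1) ^ η :=
    one_le_mul_of_one_le_of_one_le (one_le_pow₀ (by norm_num))
      (Real.one_le_rpow (by linarith [Nat.cast_nonneg (α := ℝ) n]) hη0)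
  refine ⟨unitBallVolume (Fin n) / (240 ^ n * ((n : ℝ) + 1) ^ η), 5 ^ n * unitBallVolume (Fin n),
    by positivity, by positivity, ?_⟩
  intro R hR hRσ _ _ Ω hΩ S hS
  have hR0 : 0 < R := by linarith
  rw [iUnion_closedBall_eq_latticeBalls n (by omega) σ R hR0] at hΩ
  have hμ : ∀ x r, (volume.restrict Ω) (Metric.closedBall x r) =
      volume (Metric.closedBall x r ∩ latticeBalls (mesh n σ R) (meshCount n σ R) (1 / R)) :=
    fun x r => by rw [Measure.restrict_apply measurableSet_closedBall, hΩ]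
  have hupper : S ≤ ENNReal.ofReal (5 ^ n * unitBallVolume (Fin n) *
      R ^ max (η - n) (-(σ * ((n : ℝ) + 1)))) := by
    rw [hS]
    refine iSup_le fun x => iSup₂_le fun r hr => ?_
    rw [hμ]
    refine ENNReal.div_le_of_le_mul ?_
    rw [← ENNReal.ofReal_mul (by positivity)]
    exact volume_closedBall_inter_le_rpow n hn σ hσ0 hσ1 η hη0 hηn R hR x r hr
  have hlower : ∀ (r a : ℝ), 0 < r → ENNReal.ofReal (a * r ^ η) ≤
      volume (Metric.closedBall 0 r ∩ latticeBalls (mesh n σ R) (meshCount n σ R) (1 / R)) →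
      ENNReal.ofReal a ≤ S := by
    intro r a hr h
    have hrη : 0 < r ^ η := by positivity
    rw [hS]
    refine le_trans ?_ (le_iSup_of_le 0 (le_iSup₂_of_le r hr le_rfl))
    rw [hμ, ENNReal.le_div_iff_mul_le (Or.inl (by simpa using hrη))
      (Or.inl ENNReal.ofReal_ne_top), ← ENNReal.ofReal_mul' hrη.le]
    exact h
  refine ⟨fun h => ⟨?_, ?_⟩, fun h => ⟨?_, ?_⟩⟩
  · have hn1 : 0 < (n : ℝ) + 1 := by positivity
    refine hlower ((n : ℝ) + 1) _ hn1 ?_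
    have hsub := latticeBalls_subset_closedBall (mesh n σ R) (meshCount n σ R) (1 / R)
      (by rw [div_le_one hR0]; linarith) (mesh_pos n σ R hR0) (meshCount_mul_mesh_le n σ R hR0)
    rw [Fintype.card_fin] at hsub
    rw [Set.inter_eq_right.2 hsub]
    refine le_trans (le_of_eq (congrArg _ ?_))
      (rpow_le_volume_latticeBalls n hn σ hσ0 R hR hRσ)
    have : 0 < ((n : ℝ) + 1) ^ η := by positivity
    field_simp
  · rwa [max_eq_right (by linarith)] at hupper
  · refine hlower (1 / R) _ (by positivity) ?_
    have hsub : Metric.closedBall (0 : EuclideanSpace ℝ (Fin n)) (1 / R) ⊆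
        latticeBalls (mesh n σ R) (meshCount n σ R) (1 / R) := by
      have h0 : latticePoint (mesh n σ R) 0 = 0 := by
        ext j
        simp [latticePoint]
      rw [← h0]
      exact Set.subset_biUnion_of_mem (u := fun f => Metric.closedBall
        (latticePoint (mesh n σ R) f) (1 / R)) (Finset.mem_coe.2 (by simp))
    rw [Set.inter_eq_left.2 hsub, volume_closedBall_eq _ (by positivity), Fintype.card_fin]
    refine ENNReal.ofReal_le_ofReal ?_
    have h1 : R ^ (η - n) * (1 / R) ^ η = (1 / R) ^ n := by
      rw [one_div, Real.inv_rpow hR0.le, ← Real.rpow_neg hR0.le, ← Real.rpow_add hR0, inv_pow,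
        ← Real.rpow_natCast, ← Real.rpow_neg hR0.le]
      ring_nf
    rw [mul_assoc, h1, mul_comm]
    gcongr
    exact div_le_self hV.le hK
  · rwa [max_eq_left (by linarith)] at hupper
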